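/- arXiv:1703.08528 — 4 statements merged into one kernel-verified Lean document; each statement's English description precedes it below -/
import Mathlib

section
/- An alternating 2-form ξ on ℝ⁷ satisfies ξ∧ψ = 0 if and only if there exist a vector X = X₁e₁+⋯+X₆e₆ in the span of e₁,…,e₆ and an alternating 2-form η on that span satisfying η∧ω∧ω = 0, η∧Re Ω = 0 and η∧Im Ω = 0, such that ξ = e⁰∧(X₁e² − X₂e¹ + X₃e⁴ − X₄e³ + X₅e⁶ − X₆e⁵) + ½ (X⌟Re Ω) + ½ η. Moreover X and η are uniquely determined by ξ. (This is the paper's description Ω²₁₄(CM) = { r²dr∧JX + ½ r³(X⌟Re Ω + η) : X ∈ Ω¹(M), η ∈ Ω²₈(M) }, evaluated pointwise.) -/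
open scoped TensorProduct

noncomputable section

/-- ℝ⁷ with standard basis indexed by `Fin 7`. -/
abbrev V7 : Type := Fin 7 → ℝ

/-- Alternating `k`-forms on ℝ⁷. -/
abbrev Form (k : ℕ) : Type := V7 [⋀^Fin k]→ₗ[ℝ] ℝ

/-- Wedge product of alternating forms (determinant convention, so that
`(e⁰∧e¹)(e₀,e₁) = 1`). -/
def wedge {p q : ℕ} (α : Form p) (β : Form q) : Form (p + q) :=
  (((TensorProduct.lid ℝ ℝ).toLinearMap).compAlternatingMap
    (α.domCoprod β)).domDomCongr finSumFinEquiv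

/-- The standard basis vectors e₀, …, e₆ of ℝ⁷. -/
def E (i : Fin 7) : V7 := Pi.single i 1

/-- The dual basis 1-forms e⁰, …, e⁶. -/
def ec (i : Fin 7) : Form 1 := AlternatingMap.ofSubsingleton ℝ V7 ℝ 0 (LinearMap.proj i)

/-- ω = e¹∧e² + e³∧e⁴ + e⁵∧e⁶ (on the span of e₁,…,e₆). -/
def ω : Form 2 := wedge (ec 1) (ec 2) + wedge (ec 3) (ec 4) + wedge (ec 5) (ec 6)

/-- Re Ω = e²∧e⁴∧e⁶ − e¹∧e³∧e⁶ − e²∧e³∧e⁵ − e¹∧e⁴∧e⁵. -/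
def ReΩ : Form 3 :=
  wedge (ec 2) (wedge (ec 4) (ec 6)) - wedge (ec 1) (wedge (ec 3) (ec 6))
    - wedge (ec 2) (wedge (ec 3) (ec 5)) - wedge (ec 1) (wedge (ec 4) (ec 5))

/-- Im Ω = e¹∧e³∧e⁵ − e²∧e⁴∧e⁵ − e¹∧e⁴∧e⁶ − e²∧e³∧e⁶. -/
def ImΩ : Form 3 :=
  wedge (ec 1) (wedge (ec 3) (ec 5)) - wedge (ec 2) (wedge (ec 4) (ec 5))
    - wedge (ec 1) (wedge (ec 4) (ec 6)) - wedge (ec 2) (wedge (ec 3) (ec 6))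

/-- The standard G₂ 3-form φ = e⁰∧ω + Re Ω. -/
def φ : Form 3 := wedge (ec 0) ω + ReΩ

/-- ψ = −e⁰∧Im Ω + ½ ω∧ω (the 4-form ∗φ). -/
def ψ : Form 4 := -(wedge (ec 0) ImΩ) + (1/2 : ℝ) • wedge ω ω

/-- The volume form e⁰∧e¹∧⋯∧e⁶. -/
def vol7 : Form 7 :=
  wedge (ec 0) (wedge (ec 1) (wedge (ec 2) (wedge (ec 3) (wedge (ec 4) (wedge (ec 5) (ec 6))))))

/-- The inner product on 2-forms making the eⁱ∧eʲ (i<j) orthonormal. -/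
def inner2 (α β : Form 2) : ℝ := (1/2) * ∑ i, ∑ j, α ![E i, E j] * β ![E i, E j]


/-- The 1-form e⁰∧(JX)♭-part datum: JX♭ = X₁e² − X₂e¹ + X₃e⁴ − X₄e³ + X₅e⁶ − X₆e⁵. -/
def Jflat (X : V7) : Form 1 :=
  X 1 • ec 2 - X 2 • ec 1 + X 3 • ec 4 - X 4 • ec 3 + X 5 • ec 6 - X 6 • ec 5

/-- The decomposition property: X lies in the span of e₁,…,e₆, η is a 2-form on that
span (i.e. e₀⌟η = 0) with η∧ω∧ω = 0, η∧Re Ω = 0, η∧Im Ω = 0, and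
ξ = e⁰∧(JX)♭ + ½ (X⌟Re Ω) + ½ η. -/
def IsLam14Decomp (ξ : Form 2) (X : V7) (η : Form 2) : Prop :=
  X 0 = 0 ∧ η.curryLeft (E 0) = 0 ∧
  wedge (wedge η ω) ω = 0 ∧ wedge η ReΩ = 0 ∧ wedge η ImΩ = 0 ∧
  ξ = wedge (ec 0) (Jflat X) + (1/2 : ℝ) • ReΩ.curryLeft X + (1/2 : ℝ) • η

namespace AlternatingForm

open Function

lemma wedge_add_left {p q : ℕ} (α α' : Form p) (β : Form q) :
    wedge (α + α') β = wedge α β + wedge α' β := by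
  ext v
  simp [wedge, ← AlternatingMap.domCoprod'_apply, TensorProduct.add_tmul]

lemma wedge_add_right {p q : ℕ} (α : Form p) (β β' : Form q) :
    wedge α (β + β') = wedge α β + wedge α β' := by
  ext v
  simp [wedge, ← AlternatingMap.domCoprod'_apply, TensorProduct.tmul_add]

lemma wedge_smul_left {p q : ℕ} (c : ℝ) (α : Form p) (β : Form q) :
    wedge (c • α) β = c • wedge α β := by
  ext v
  simp [wedge, ← AlternatingMap.domCoprod'_apply, ← TensorProduct.smul_tmul']

lemma wedge_smul_right {p q : ℕ} (c : ℝ) (α : Form p) (β : Form q) :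
    wedge α (c • β) = c • wedge α β := by
  ext v
  simp [wedge, ← AlternatingMap.domCoprod'_apply]

/-- The wedge product as a bilinear map. -/
def wedgeBilin (p q : ℕ) : Form p →ₗ[ℝ] Form q →ₗ[ℝ] Form (p + q) :=
  LinearMap.mk₂ ℝ wedge wedge_add_left wedge_smul_left wedge_add_right wedge_smul_right

lemma wedge_sub_left {p q : ℕ} (α α' : Form p) (β : Form q) :
    wedge (α - α') β = wedge α β - wedge α' β :=
  (wedgeBilin p q).map_sub₂ α α' β

lemma wedge_sub_right {p q : ℕ} (α : Form p) (β β' : Form q) :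
    wedge α (β - β') = wedge α β - wedge α β' :=
  map_sub (wedgeBilin p q α) β β'

/-- Evaluation of a form at a tuple of vectors, as a linear map. -/
def evalAt {k : ℕ} (v : Fin k → V7) : Form k →ₗ[ℝ] ℝ where
  toFun α := α v
  map_add' _ _ := rfl
  map_smul' _ _ := rfl

lemma evalAt_apply {k : ℕ} (v : Fin k → V7) (α : Form k) : evalAt v α = α v := rfl

/-- The product of the coordinates `I 0, …, I (k - 1)`, as a multilinear map. -/
def coordProd {k : ℕ} (I : Fin k → Fin 7) : MultilinearMap ℝ (fun _ : Fin k => V7) ℝ :=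
  (MultilinearMap.mkPiAlgebra ℝ (Fin k) ℝ).compLinearMap fun b => LinearMap.proj (I b)

/-- The monomial form `e^{I 0} ∧ ⋯ ∧ e^{I (k - 1)}`. -/
def mono {k : ℕ} (I : Fin k → Fin 7) : Form k :=
  MultilinearMap.alternatization (coordProd I)

lemma mono_apply {k : ℕ} (I : Fin k → Fin 7) (v : Fin k → V7) :
    mono I v = Matrix.det (Matrix.of fun a b => v a (I b)) := by
  simp [mono, coordProd, MultilinearMap.alternatization_apply, Matrix.det_apply]

lemma wedge_mono {p q : ℕ} (I : Fin p → Fin 7) (J : Fin q → Fin 7) :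
    wedge (mono I) (mono J) = mono (Fin.append I J) := by
  rw [wedge, mono, mono, ← MultilinearMap.domCoprod_alternization]
  ext v
  simp only [AlternatingMap.domDomCongr_apply, LinearMap.compAlternatingMap_apply,
    MultilinearMap.alternatization_apply, mono, map_sum, coordProd]
  rw [← Equiv.sum_comp (Equiv.permCongr finSumFinEquiv)]
  refine Finset.sum_congr rfl fun σ _ => ?_
  rcases Int.units_eq_one_or (Equiv.Perm.sign σ) with h | h <;>
    simp [Fin.prod_univ_add, h]

/-- The value of `mono I` on the basis vectors indexed by `J`, as a computable integer. -/
def coef : (k : ℕ) → (Fin k → Fin 7) → (Fin k → Fin 7) → ℤ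
  | 0, _, _ => 1
  | k + 1, I, J => ∑ a : Fin (k + 1),
      if J a = I 0 then (-1) ^ (a : ℕ) * coef k (I ∘ Fin.succ) (J ∘ a.succAbove) else 0

lemma mono_basis {k : ℕ} (I J : Fin k → Fin 7) : mono I (E ∘ J) = (coef k I J : ℝ) := by
  rw [mono_apply]
  induction k with
  | zero => simp [coef]
  | succ k ih =>
    rw [Matrix.det_succ_column_zero, coef]
    push_cast
    refine Finset.sum_congr rfl fun a _ => ?_
    rw [← ih]
    by_cases h : J a = I 0
    · simp [E, h]; rfl
    · simp [E, h, Ne.symm h]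

lemma mono_eq_zero {k : ℕ} {I : Fin k → Fin 7} {a b : Fin k} (hab : a ≠ b) (h : I a = I b) :
    mono I = 0 := by
  ext v
  rw [mono_apply, Matrix.det_zero_of_column_eq hab fun c => by simp [h]]
  rfl

lemma ec_eq (i : Fin 7) : ec i = mono ![i] := by
  ext v
  simp [mono_apply, ec]

lemma form_ext {k : ℕ} {α β : Form k}
    (h : ∀ J : Fin k → Fin 7, Injective J → α (E ∘ J) = β (E ∘ J)) : α = β := by
  refine (Pi.basisFun ℝ (Fin 7)).ext_alternating fun J hJ => ?_
  have : (fun i => Pi.basisFun ℝ (Fin 7) (J i)) = E ∘ J := by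
    ext1 i; simp [E]
  rw [this]
  exact h J hJ

lemma exists_eq_succAbove_comp {m n : ℕ} (hmn : m ≤ n) (J : Fin m → Fin (n + 1))
    (hJ : Injective J) : ∃ (a : Fin (n + 1)) (K : Fin m → Fin n),
      Injective K ∧ J = a.succAbove ∘ K := by
  obtain ⟨a, ha⟩ : ∃ a, ∀ i, J i ≠ a := by
    by_contra! h
    have := Fintype.card_le_of_surjective J h
    simp at this
    omega
  choose K hK using fun i => Fin.exists_succAbove_eq (ha i)
  have hc : J = a.succAbove ∘ K := funext fun i => (hK i).symm
  exact ⟨a, K, Injective.of_comp (hc ▸ hJ), hc⟩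

lemma apply_comp_injective {k : ℕ} (α : Form k) (f : Fin k → V7) (K : Fin k → Fin k)
    (hK : Injective K) (h : α f = 0) : α (f ∘ K) = 0 := by
  have := α.map_perm f (Equiv.ofBijective K (Finite.injective_iff_bijective.1 hK))
  simpa [h] using this

lemma form_six_eq_zero {α : Form 6} (h : ∀ a : Fin 7, α (E ∘ a.succAbove) = 0) : α = 0 := by
  refine form_ext fun J hJ => ?_
  obtain ⟨a, K, hK, rfl⟩ := exists_eq_succAbove_comp (by norm_num) J hJ
  exact apply_comp_injective α (E ∘ a.succAbove) K hK (h a)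

lemma wedge_wedge_eq_zero_of_apply {α β γ : Form 2}
    (h : ∀ a : Fin 7, wedge (wedge α β) γ (E ∘ a.succAbove) = 0) : wedge (wedge α β) γ = 0 := by
  generalize wedge (wedge α β) γ = δ at h ⊢
  exact form_six_eq_zero (α := δ) h

lemma form_five_eq_zero {α : Form (2 + 3)} (h0 : ∀ b : Fin 6, α (E ∘ Fin.succ ∘ b.succAbove) = 0)
    (h : ∀ (a : Fin 6) (b : Fin 5), α (E ∘ a.succ.succAbove ∘ b.succ.succAbove) = 0) : α = 0 := by
  refine form_ext fun J hJ => ?_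
  obtain ⟨a, K, hK, rfl⟩ := exists_eq_succAbove_comp (by norm_num) J hJ
  obtain ⟨b, L, hL, rfl⟩ := exists_eq_succAbove_comp (by norm_num) K hK
  refine apply_comp_injective α (E ∘ a.succAbove ∘ b.succAbove) L hL ?_
  cases a using Fin.cases with
  | zero => simpa only [Fin.succAbove_zero] using h0 b
  | succ a =>
    cases b using Fin.cases with
    | zero =>
      have : a.succ.succAbove ∘ Fin.succAbove 0 = Fin.succ ∘ a.succAbove := by
        ext1 i; simp
      rw [this]
      exact h0 a
    | succ b => exact h a b

lemma form_two_ext {α β : Form 2} (h : ∀ i j, α ![E i, E j] = β ![E i, E j]) : α = β := by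
  refine form_ext fun J _ => ?_
  have : E ∘ J = ![E (J 0), E (J 1)] := by
    ext1 i; fin_cases i <;> rfl
  rw [this]
  exact h _ _

lemma mono_two_basis (a b i j : Fin 7) :
    mono ![a, b] ![E i, E j] = (coef 2 ![a, b] ![i, j] : ℝ) := by
  rw [← mono_basis]
  congr 1
  ext1 i; fin_cases i <;> rfl

lemma apply_swap (α : Form 2) (v w : V7) : α ![w, v] = - α ![v, w] := by
  have := α.map_swap ![v, w] (show (0 : Fin 2) ≠ 1 by decide)
  rw [← this]
  congr 1
  ext1 i; fin_cases i <;> rfl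

lemma form_two_expand (α : Form 2) :
    α = (1 / 2 : ℝ) • ∑ i, ∑ j, α ![E i, E j] • mono ![i, j] := by
  refine form_two_ext fun a b => ?_
  rw [← evalAt_apply _ (_ • _)]
  simp only [map_smul, map_sum, evalAt_apply, mono_two_basis, smul_eq_mul]
  have h : ∀ i j, coef 2 ![i, j] ![a, b] =
      (if i = a then if j = b then 1 else 0 else 0) -
        (if i = b then if j = a then 1 else 0 else 0) := by
    revert a b; decide
  simp [h, mul_sub, apply_swap α (E a) (E b)]
  ring

lemma curryLeft_E_zero_eq_zero_iff {η : Form 2} :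
    η.curryLeft (E 0) = 0 ↔ ∀ j, η ![E 0, E j] = 0 := by
  refine ⟨fun h j => by simpa using congrArg (fun γ : Form 1 => γ ![E j]) h,
    fun h => form_ext fun J _ => ?_⟩
  have : E ∘ J = ![E (J 0)] := by
    ext1 i; fin_cases i; rfl
  simpa [this] using h (J 0)

lemma mono_two_swap (i j : Fin 7) : mono ![i, j] = - mono ![j, i] := by
  ext v
  simp [mono_apply, Matrix.det_fin_two]

/-- On 2-forms whose contraction with `e₀` vanishes, proportionality of two linear functionals can
be tested on the monomials not involving `e⁰`. -/
lemma map_eq_mul_of_horizontal {f g : Form 2 →ₗ[ℝ] ℝ} {c : ℝ} (h : ∀ i j : Fin 6, i < j →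
      f (mono ![i.succ, j.succ]) = c * g (mono ![i.succ, j.succ]))
    {η : Form 2} (hη : η.curryLeft (E 0) = 0) : f η = c * g η := by
  have h0 := curryLeft_E_zero_eq_zero_iff.1 hη
  have h0' : ∀ j, η ![E j, E 0] = 0 := fun j => by rw [apply_swap, h0, neg_zero]
  have hf : ∀ i j : Fin 6, f (mono ![i.succ, j.succ]) = c * g (mono ![i.succ, j.succ]) := by
    intro i j
    rcases lt_trichotomy i j with hij | rfl | hij
    · exact h i j hij
    · simp [mono_eq_zero (I := ![i.succ, i.succ]) (show (0 : Fin 2) ≠ 1 by decide) rfl]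
    · rw [mono_two_swap, map_neg, map_neg, h j i hij, mul_neg]
  rw [form_two_expand η]
  simp only [map_smul, map_sum, Fin.sum_univ_succ (n := 6), h0, h0', zero_smul, hf,
    Finset.sum_const_zero, zero_add, smul_eq_mul, Finset.mul_sum, mul_left_comm]

lemma wedge_apply_eq_mul {q r : ℕ} {β : Form q} {γ : Form r} {v : Fin (2 + q) → V7}
    {w : Fin (2 + r) → V7} {c : ℝ} (h : ∀ i j : Fin 6, i < j →
      wedge (mono ![i.succ, j.succ]) β v = c * wedge (mono ![i.succ, j.succ]) γ w)
    {η : Form 2} (hη : η.curryLeft (E 0) = 0) : wedge η β v = c * wedge η γ w :=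
  map_eq_mul_of_horizontal (f := evalAt v ∘ₗ (wedgeBilin 2 q).flip β)
    (g := evalAt w ∘ₗ (wedgeBilin 2 r).flip γ) h hη

lemma wedge_wedge_apply_eq_mul {q q' r : ℕ} {β : Form q} {β' : Form q'} {γ : Form r}
    {v : Fin (2 + q + q') → V7} {w : Fin (2 + r) → V7} {c : ℝ} (h : ∀ i j : Fin 6, i < j →
      wedge (wedge (mono ![i.succ, j.succ]) β) β' v = c * wedge (mono ![i.succ, j.succ]) γ w)
    {η : Form 2} (hη : η.curryLeft (E 0) = 0) :
    wedge (wedge η β) β' v = c * wedge η γ w :=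
  map_eq_mul_of_horizontal
    (f := evalAt v ∘ₗ (wedgeBilin (2 + q) q').flip β' ∘ₗ (wedgeBilin 2 q).flip β)
    (g := evalAt w ∘ₗ (wedgeBilin 2 r).flip γ) h hη

lemma ω_eq : ω = mono ![1, 2] + mono ![3, 4] + mono ![5, 6] := by
  simp only [ω, ec_eq, wedge_mono]
  refine form_ext fun J _ => ?_
  simp only [AlternatingMap.add_apply, mono_basis]
  rfl

lemma ReΩ_eq : ReΩ = mono ![2, 4, 6] - mono ![1, 3, 6] - mono ![2, 3, 5] - mono ![1, 4, 5] := by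
  simp only [ReΩ, ec_eq, wedge_mono]
  congr <;> ext i <;> fin_cases i <;> rfl

lemma ImΩ_eq : ImΩ = mono ![1, 3, 5] - mono ![2, 4, 5] - mono ![1, 4, 6] - mono ![2, 3, 6] := by
  simp only [ImΩ, ec_eq, wedge_mono]
  congr <;> ext i <;> fin_cases i <;> rfl

lemma mono_four_swap (a b c d : Fin 7) : mono ![c, d, a, b] = mono ![a, b, c, d] := by
  ext v
  simp [mono_apply, Matrix.det_succ_column_zero, Fin.sum_univ_succ, Fin.succAbove]
  ring

lemma wedge_ω_ω : wedge ω ω = (2 : ℝ) •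
    (mono ![1, 2, 3, 4] + mono ![1, 2, 5, 6] + mono ![3, 4, 5, 6]) := by
  rw [ω_eq]
  simp only [wedge_add_left, wedge_add_right, wedge_mono]
  have h0 : ∀ a b : Fin 7, mono (Fin.append ![a, b] ![a, b]) = 0 := fun a b =>
    mono_eq_zero (show (0 : Fin 4) ≠ 2 by decide) rfl
  have happ : ∀ a b c d : Fin 7, Fin.append ![a, b] ![c, d] = ![a, b, c, d] := fun a b c d => by
    ext i; fin_cases i <;> rfl
  simp only [h0]
  simp only [happ]
  rw [mono_four_swap 1 2 3 4, mono_four_swap 1 2 5 6, mono_four_swap 3 4 5 6]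
  module

lemma ψ_eq : ψ = mono ![1, 2, 3, 4] + mono ![1, 2, 5, 6] + mono ![3, 4, 5, 6] -
    (mono ![0, 1, 3, 5] - mono ![0, 2, 4, 5] - mono ![0, 1, 4, 6] - mono ![0, 2, 3, 6]) := by
  have h : wedge (ec 0) ImΩ = mono ![0, 1, 3, 5] - mono ![0, 2, 4, 5] - mono ![0, 1, 4, 6]
      - mono ![0, 2, 3, 6] := by
    simp only [ImΩ_eq, ec_eq, wedge_mono, wedge_sub_right]
    congr <;> ext i <;> fin_cases i <;> rfl
  rw [ψ, wedge_ω_ω, smul_smul, h]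
  norm_num
  abel

lemma wedge_ImΩ_succ {η : Form 2} (hη : η.curryLeft (E 0) = 0) (k : Fin 6) :
    wedge η ImΩ (E ∘ Fin.succ ∘ k.succAbove) =
      ((-1 : ℤ) : ℝ) * wedge η ψ (E ∘ k.succ.succAbove) := by
  refine wedge_apply_eq_mul (fun i j hij => ?_) hη
  simp only [ImΩ_eq, ψ_eq, wedge_sub_right, wedge_add_right, wedge_mono,
    AlternatingMap.sub_apply, AlternatingMap.add_apply, mono_basis]
  norm_cast
  revert i j k
  decide +kernel

lemma wedge_ReΩ_succ {η : Form 2} (hη : η.curryLeft (E 0) = 0) (k : Fin 6) :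
    wedge η ReΩ (E ∘ Fin.succ ∘ k.succAbove) = (((-1) ^ k.val : ℤ) : ℝ) *
      wedge η ψ (E ∘ (![1, 0, 3, 2, 5, 4] k : Fin 6).succ.succAbove) := by
  refine wedge_apply_eq_mul (fun i j hij => ?_) hη
  simp only [ReΩ_eq, ψ_eq, wedge_sub_right, wedge_add_right, wedge_mono,
    AlternatingMap.sub_apply, AlternatingMap.add_apply, mono_basis]
  norm_cast
  revert i j k
  decide +kernel

lemma wedge_ImΩ_succ_succ {η : Form 2} (hη : η.curryLeft (E 0) = 0) (a : Fin 6) (b : Fin 5) :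
    wedge η ImΩ (E ∘ a.succ.succAbove ∘ b.succ.succAbove) = 0 := by
  rw [← zero_mul (wedge η ImΩ (E ∘ a.succ.succAbove ∘ b.succ.succAbove))]
  refine wedge_apply_eq_mul (fun i j hij => ?_) hη
  simp only [ImΩ_eq, wedge_sub_right, wedge_mono, zero_mul,
    AlternatingMap.sub_apply, mono_basis]
  norm_cast
  revert i j a b
  decide +kernel

lemma wedge_ReΩ_succ_succ {η : Form 2} (hη : η.curryLeft (E 0) = 0) (a : Fin 6) (b : Fin 5) :
    wedge η ReΩ (E ∘ a.succ.succAbove ∘ b.succ.succAbove) = 0 := by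
  rw [← zero_mul (wedge η ReΩ (E ∘ a.succ.succAbove ∘ b.succ.succAbove))]
  refine wedge_apply_eq_mul (fun i j hij => ?_) hη
  simp only [ReΩ_eq, wedge_sub_right, wedge_mono, zero_mul,
    AlternatingMap.sub_apply, mono_basis]
  norm_cast
  revert i j a b
  decide +kernel

lemma wedge_ω_ω_apply {η : Form 2} (hη : η.curryLeft (E 0) = 0) (k : Fin 7) :
    wedge (wedge η ω) ω (E ∘ k.succAbove) = ((if k = 0 then 2 else 0 : ℤ) : ℝ) *
      wedge η ψ (E ∘ Fin.succAbove 0) := by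
  refine wedge_wedge_apply_eq_mul (fun i j hij => ?_) hη
  simp only [ω_eq, ψ_eq, wedge_sub_right, wedge_add_right, wedge_add_left, wedge_mono,
    AlternatingMap.sub_apply, AlternatingMap.add_apply, mono_basis]
  norm_cast
  revert i j k
  decide +kernel

/-- For 2-forms `η` on the span of `e₁, …, e₆`, the equation `η ∧ ψ = 0` says that `η` is primitive
of type `(1, 1)`. -/
lemma wedge_ψ_eq_zero_iff {η : Form 2} (hη : η.curryLeft (E 0) = 0) :
    wedge η ψ = 0 ↔
      wedge (wedge η ω) ω = 0 ∧ wedge η ReΩ = 0 ∧ wedge η ImΩ = 0 := by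
  constructor
  · intro h
    refine ⟨wedge_wedge_eq_zero_of_apply fun a => ?_,
      form_five_eq_zero (fun b => ?_) fun a b => ?_,
      form_five_eq_zero (fun b => ?_) fun a b => ?_⟩
    · rw [wedge_ω_ω_apply hη, h, AlternatingMap.zero_apply, mul_zero]
    · rw [wedge_ReΩ_succ hη, h, AlternatingMap.zero_apply, mul_zero]
    · rw [wedge_ReΩ_succ_succ hη]
    · rw [wedge_ImΩ_succ hη, h, AlternatingMap.zero_apply, mul_zero]
    · rw [wedge_ImΩ_succ_succ hη]
  · rintro ⟨hω, -, hI⟩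
    refine form_six_eq_zero fun a => ?_
    cases a using Fin.cases with
    | zero => simpa [hω] using wedge_ω_ω_apply hη 0
    | succ k => simpa [hI] using wedge_ImΩ_succ hη k

/-- The part of the decomposition determined by `X`, in monomials. -/
lemma horizontal_part_eq (X : V7) :
    wedge (ec 0) (Jflat X) + (1 / 2 : ℝ) • ReΩ.curryLeft X = (1 / 2 : ℝ) •
      (X 1 • (mono ![0, 2] + mono ![0, 2] - mono ![3, 6] - mono ![4, 5])
      + X 2 • (mono ![4, 6] - mono ![3, 5] - mono ![0, 1] - mono ![0, 1])
      + X 3 • (mono ![0, 4] + mono ![0, 4] + mono ![1, 6] + mono ![2, 5])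
      + X 4 • (mono ![1, 5] - mono ![2, 6] - mono ![0, 3] - mono ![0, 3])
      + X 5 • (mono ![0, 6] + mono ![0, 6] - mono ![2, 3] - mono ![1, 4])
      + X 6 • (mono ![2, 4] - mono ![1, 3] - mono ![0, 5] - mono ![0, 5])) := by
  have hw : ∀ a b : Fin 7, wedge (mono ![a]) (mono ![b]) = mono ![a, b] := fun a b => by
    rw [wedge_mono]
    congr 1
    ext i; fin_cases i <;> rfl
  ext v
  simp only [Jflat, ec_eq, wedge_add_right, wedge_sub_right, wedge_smul_right, hw,
    AlternatingMap.add_apply, AlternatingMap.sub_apply, AlternatingMap.smul_apply,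
    AlternatingMap.curryLeft_apply_apply, ReΩ_eq, mono_apply, Matrix.det_fin_two,
    Matrix.det_fin_three, smul_eq_mul, Matrix.of_apply]
  simp
  ring

lemma wedge_horizontal_part (X : V7) :
    wedge (wedge (ec 0) (Jflat X) + (1 / 2 : ℝ) • ReΩ.curryLeft X) ψ = 0 := by
  rw [horizontal_part_eq]
  have h : wedge (mono ![0, 2] + mono ![0, 2] - mono ![3, 6] - mono ![4, 5]) ψ = 0 ∧
      wedge (mono ![4, 6] - mono ![3, 5] - mono ![0, 1] - mono ![0, 1]) ψ = 0 ∧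
      wedge (mono ![0, 4] + mono ![0, 4] + mono ![1, 6] + mono ![2, 5]) ψ = 0 ∧
      wedge (mono ![1, 5] - mono ![2, 6] - mono ![0, 3] - mono ![0, 3]) ψ = 0 ∧
      wedge (mono ![0, 6] + mono ![0, 6] - mono ![2, 3] - mono ![1, 4]) ψ = 0 ∧
      wedge (mono ![2, 4] - mono ![1, 3] - mono ![0, 5] - mono ![0, 5]) ψ = 0 := by
    refine ⟨?_, ?_, ?_, ?_, ?_, ?_⟩ <;>
    · refine form_six_eq_zero fun a => ?_
      simp only [ψ_eq, wedge_sub_left, wedge_add_left, wedge_sub_right, wedge_add_right,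
        wedge_mono, AlternatingMap.sub_apply, AlternatingMap.add_apply, mono_basis]
      norm_cast
      revert a
      decide +kernel
  obtain ⟨h1, h2, h3, h4, h5, h6⟩ := h
  simp only [wedge_smul_left, wedge_add_left, h1, h2, h3, h4, h5, h6, smul_zero, add_zero]

/-- The contraction of the part of the decomposition determined by `X` with `e₀`. -/
lemma horizontal_part_apply (X : V7) (j : Fin 7) :
    (wedge (ec 0) (Jflat X) + (1 / 2 : ℝ) • ReΩ.curryLeft X) ![E 0, E j] =
      ![0, - X 2, X 1, - X 4, X 3, - X 6, X 5] j := by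
  rw [horizontal_part_eq]
  simp only [AlternatingMap.add_apply, AlternatingMap.sub_apply, AlternatingMap.smul_apply,
    mono_apply, Matrix.det_fin_two, smul_eq_mul, Matrix.of_apply]
  fin_cases j <;> simp [E] <;> ring

lemma apply_E_zero_of_decomp {ξ η : Form 2} {X : V7} (h : IsLam14Decomp ξ X η) (j : Fin 7) :
    ξ ![E 0, E j] = ![0, - X 2, X 1, - X 4, X 3, - X 6, X 5] j := by
  obtain ⟨-, hη, -, -, -, rfl⟩ := h
  rw [AlternatingMap.add_apply, AlternatingMap.smul_apply,
    curryLeft_E_zero_eq_zero_iff.1 hη, horizontal_part_apply, smul_zero, add_zero]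

end AlternatingForm

open AlternatingForm in
/-- A 2-form ξ on ℝ⁷ satisfies ξ∧ψ = 0 iff it can be written as
ξ = e⁰∧(JX)♭ + ½ X⌟Re Ω + ½ η with X in the span of e₁,…,e₆ and η a 2-form on that span
with η∧ω∧ω = 0, η∧Re Ω = 0 and η∧Im Ω = 0; moreover X and η are uniquely determined by ξ.
(The paper's pointwise description of Ω²₁₄(CM).) -/
theorem lambda_two_14_description (ξ : Form 2) :
    (wedge ξ ψ = 0 ↔ ∃ X η, IsLam14Decomp ξ X η) ∧
    (∀ X η X' η', IsLam14Decomp ξ X η → IsLam14Decomp ξ X' η' → X = X' ∧ η = η') := by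
  refine ⟨⟨fun h => ?_, ?_⟩, fun X η X' η' h h' => ?_⟩
  · set X : V7 := ![0, ξ ![E 0, E 2], - ξ ![E 0, E 1], ξ ![E 0, E 4], - ξ ![E 0, E 3],
      ξ ![E 0, E 6], - ξ ![E 0, E 5]] with hX
    set α : Form 2 := wedge (ec 0) (Jflat X) + (1 / 2 : ℝ) • ReΩ.curryLeft X with hα
    have hη : ((2 : ℝ) • (ξ - α)).curryLeft (E 0) = 0 := by
      refine curryLeft_E_zero_eq_zero_iff.2 fun j => ?_
      rw [AlternatingMap.smul_apply, AlternatingMap.sub_apply, hα, horizontal_part_apply]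
      fin_cases j
      · simp [hX, ξ.map_eq_zero_of_eq ![E 0, E 0] (i := 0) (j := 1) rfl (by decide)]
      all_goals simp [hX]
    have hψ : wedge ((2 : ℝ) • (ξ - α)) ψ = 0 := by
      rw [wedge_smul_left, wedge_sub_left, h, hα, wedge_horizontal_part, sub_zero, smul_zero]
    obtain ⟨h1, h2, h3⟩ := (wedge_ψ_eq_zero_iff hη).1 hψ
    refine ⟨X, _, rfl, hη, h1, h2, h3, ?_⟩
    rw [← hα]
    module
  · rintro ⟨X, η, -, hη, h1, h2, h3, rfl⟩
    rw [wedge_add_left, wedge_horizontal_part, wedge_smul_left,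
      (wedge_ψ_eq_zero_iff hη).2 ⟨h1, h2, h3⟩, smul_zero, add_zero]
  · have hX : X = X' := by
      have hj := fun j => (apply_E_zero_of_decomp h j).symm.trans (apply_E_zero_of_decomp h' j)
      ext i
      fin_cases i
      · exact h.1.trans h'.1.symm
      · exact hj 2
      · exact neg_injective (hj 1)
      · exact hj 4
      · exact neg_injective (hj 3)
      · exact hj 6
      · exact neg_injective (hj 5)
    subst hX
    refine ⟨rfl, ?_⟩
    have := h.2.2.2.2.2.symm.trans h'.2.2.2.2.2
    exact smul_right_injective _ (by norm_num : (1 / 2 : ℝ) ≠ 0) (add_left_cancel this)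
end
end

section
/- Fix q > 0. There exists a constant C = C(q), independent of T, such that for every T ≥ 1, every continuous A : [0,∞) → ℝ with ‖A‖_{q,T} < ∞, and every G₀ ∈ ℝ, there is a twice continuously differentiable X : [0,∞) → ℝ satisfying X''(t) − 7X'(t) − 18X(t) = −A(t) for all t ≥ 0, the boundary condition −9X(0) + X'(0) = G₀, and the estimate ‖X‖_{q,T} ≤ C(‖A‖_{q,T} + T^q|G₀|). Explicitly one may take X(t) = α e^{−2t} + e^{−2t}∫₀ᵗ e^{11s} (∫_s^∞ e^{−9τ} A(τ) dτ) ds for a suitable α ∈ ℝ. (This is Step 3 in the proof of Lemma 3.1, solving the Killing-field modes (18 − d²/dt² + 7 d/dt)X = A with the boundary condition at t = 0.) -/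
open Set MeasureTheory

noncomputable section

lemma one_add_rpow_le_exp {q u : ℝ} (hq : 0 < q) (hu : 0 ≤ u) :
    (1 + u) ^ q ≤ q ^ q * Real.exp (1 + u) := by
  have h : (1 + u) / q ≤ Real.exp ((1 + u) / q) := by
    linarith [Real.add_one_le_exp ((1 + u) / q)]
  calc (1 + u) ^ q = q ^ q * ((1 + u) / q) ^ q := by
        rw [← Real.mul_rpow hq.le (by positivity), mul_div_cancel₀ _ hq.ne']
    _ ≤ q ^ q * Real.exp ((1 + u) / q) ^ q := by gcongr
    _ = q ^ q * Real.exp (1 + u) := by rw [← Real.exp_mul, div_mul_cancel₀ _ hq.ne']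

lemma rpow_add_le_exp_sub_mul_rpow {q T s t : ℝ} (hq : 0 < q) (hT : 1 ≤ T) (hs : 0 ≤ s)
    (hst : s ≤ t) :
    (T + t) ^ q ≤ q ^ q * Real.exp 1 * Real.exp (t - s) * (T + s) ^ q := by
  have hu : 0 ≤ t - s := sub_nonneg.2 hst
  calc (T + t) ^ q ≤ ((1 + (t - s)) * (T + s)) ^ q :=
        Real.rpow_le_rpow (by linarith) (by nlinarith [mul_nonneg hu (by linarith : 0 ≤ T + s - 1)])
          hq.le
    _ = (1 + (t - s)) ^ q * (T + s) ^ q := Real.mul_rpow (by linarith) (by linarith)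
    _ ≤ (q ^ q * Real.exp (1 + (t - s))) * (T + s) ^ q := by
        have : 0 ≤ T + s := by linarith
        gcongr
        exact one_add_rpow_le_exp hq hu
    _ = q ^ q * Real.exp 1 * Real.exp (t - s) * (T + s) ^ q := by rw [Real.exp_add]; ring

lemma hasDerivAt_integral_Ioi {f : ℝ → ℝ} (hf : Continuous f)
    (hi : ∀ a, IntegrableOn f (Ioi a)) (s : ℝ) :
    HasDerivAt (fun s => ∫ τ in Ioi s, f τ) (-f s) s := by
  have h : (fun s => ∫ τ in Ioi s, f τ) =
      fun s => (∫ τ in Ioi 0, f τ) - ∫ τ in (0 : ℝ)..s, f τ := by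
    funext s
    rw [← intervalIntegral.integral_interval_add_Ioi (hi 0) (hi s)]
    ring
  rw [h]
  exact (hf.integral_hasStrictDerivAt 0 s).hasDerivAt.const_sub _

lemma integrableOn_exp_mul_of_bounded {f : ℝ → ℝ} (hf : Continuous f) {M c : ℝ} (hc : c < 0)
    (hM : ∀ t, |f t| ≤ M) (a : ℝ) :
    IntegrableOn (fun τ => Real.exp (c * τ) * f τ) (Ioi a) :=
  (integrableOn_exp_mul_Ioi hc a).mul_bdd hf.aestronglyMeasurable (ae_of_all _ hM)

lemma abs_integral_Ioi_exp_mul_le {f : ℝ → ℝ} {c s D : ℝ} (hc : c < 0)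
    (hD : ∀ t, s < t → |f t| ≤ D) :
    |∫ τ in Ioi s, Real.exp (c * τ) * f τ| ≤ D * (Real.exp (c * s) / -c) := by
  have h := norm_integral_le_of_norm_le (μ := volume.restrict (Ioi s))
    (f := fun τ => Real.exp (c * τ) * f τ) (g := fun τ => D * Real.exp (c * τ))
    ((integrableOn_exp_mul_Ioi hc s).const_mul D)
    ((ae_restrict_iff' measurableSet_Ioi).2 (ae_of_all _ fun τ hτ => by
      rw [norm_mul, Real.norm_eq_abs, Real.abs_exp, mul_comm]
      exact mul_le_mul_of_nonneg_right (hD τ hτ) (Real.exp_pos _).le))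
  rw [integral_const_mul, integral_exp_mul_Ioi hc] at h
  rwa [Real.norm_eq_abs, neg_div, ← div_neg] at h

/-- Variation of constants for `X' = -2 X + g` propagates the weighted bound on `g`. -/
lemma rpow_mul_abs_exp_mul_integral_le {q T N : ℝ} (hq : 0 < q) (hT : 1 ≤ T) (hN : 0 ≤ N)
    {g : ℝ → ℝ} (hg : ∀ s, 0 ≤ s → (T + s) ^ q * |g s| ≤ N) {t : ℝ} (ht : 0 ≤ t) :
    (T + t) ^ q * |Real.exp (-2 * t) * ∫ s in (0 : ℝ)..t, Real.exp (2 * s) * g s| ≤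
      q ^ q * Real.exp 1 * N := by
  set K := q ^ q * Real.exp 1 with hK
  have hKpos : 0 < K := by positivity
  have hw : 0 < (T + t) ^ q := Real.rpow_pos_of_pos (by linarith) _
  have hpt : ∀ s ∈ Ioc 0 t, ‖Real.exp (2 * s) * g s‖ ≤
      K * N / (T + t) ^ q * Real.exp t * Real.exp s := by
    intro s hs
    have hws : 0 < (T + s) ^ q := Real.rpow_pos_of_pos (by linarith [hs.1]) _
    have hgs : |g s| ≤ K * N / (T + t) ^ q * Real.exp (t - s) := by
      rw [div_mul_eq_mul_div, le_div_iff₀ hw]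
      calc |g s| * (T + t) ^ q
          ≤ |g s| * (K * Real.exp (t - s) * (T + s) ^ q) := by
            gcongr
            exact rpow_add_le_exp_sub_mul_rpow hq hT hs.1.le hs.2
        _ = K * Real.exp (t - s) * ((T + s) ^ q * |g s|) := by ring
        _ ≤ K * Real.exp (t - s) * N := by
            gcongr
            exact hg s hs.1.le
        _ = K * N * Real.exp (t - s) := by ring
    rw [norm_mul, Real.norm_eq_abs, Real.abs_exp, Real.norm_eq_abs]
    calc Real.exp (2 * s) * |g s|
        ≤ Real.exp (2 * s) * (K * N / (T + t) ^ q * Real.exp (t - s)) := by gcongr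
      _ = K * N / (T + t) ^ q * (Real.exp (2 * s) * Real.exp (t - s)) := by ring
      _ = K * N / (T + t) ^ q * Real.exp t * Real.exp s := by
          rw [← Real.exp_add, mul_assoc _ (Real.exp t), ← Real.exp_add]; ring_nf
  have hint := intervalIntegral.norm_integral_le_of_norm_le ht (ae_of_all volume hpt)
    (Continuous.intervalIntegrable (by fun_prop) _ _)
  rw [intervalIntegral.integral_const_mul, integral_exp, Real.exp_zero, Real.norm_eq_abs] at hint
  have he : Real.exp (-2 * t) * (Real.exp t * Real.exp t) = 1 := by
    rw [← Real.exp_add, ← Real.exp_add, Real.exp_eq_one_iff]; ring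
  rw [abs_mul, Real.abs_exp]
  calc (T + t) ^ q * (Real.exp (-2 * t) * |∫ s in (0 : ℝ)..t, Real.exp (2 * s) * g s|)
      ≤ (T + t) ^ q * (Real.exp (-2 * t) *
          (K * N / (T + t) ^ q * Real.exp t * Real.exp t)) := by
        gcongr
        refine hint.trans ?_
        gcongr
        linarith
    _ = (T + t) ^ q / (T + t) ^ q * (K * N) *
          (Real.exp (-2 * t) * (Real.exp t * Real.exp t)) := by ring
    _ = K * N := by rw [he, div_self hw.ne']; ring

/-- Fix q > 0. There is C = C(q), independent of T, such that for every
T ≥ 1, every continuous A on [0,∞) with ‖A‖_{q,T} ≤ M, and every G₀ ∈ ℝ, there is a twice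
continuously differentiable X on [0,∞) with X'' − 7X' − 18X = −A on [0,∞),
−9X(0) + X'(0) = G₀ and (T+t)^q |X(t)| ≤ C(M + T^q|G₀|) for all t ≥ 0; explicitly
X(t) = αe^{−2t} + e^{−2t}∫₀ᵗ e^{11s}(∫ₛ^∞ e^{−9τ}A(τ)dτ)ds for suitable α. -/
theorem killing_mode_ode_solvability (q : ℝ) (hq : 0 < q) :
    ∃ C : ℝ, ∀ T : ℝ, 1 ≤ T → ∀ A : ℝ → ℝ, ContinuousOn A (Ici 0) →
      ∀ M : ℝ, (∀ t : ℝ, 0 ≤ t → (T + t) ^ q * |A t| ≤ M) →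
      ∀ G₀ : ℝ, ∃ X X' X'' : ℝ → ℝ,
        ContinuousOn X'' (Ici 0) ∧
        (∀ t ∈ Ici (0:ℝ), HasDerivWithinAt X (X' t) (Ici 0) t) ∧
        (∀ t ∈ Ici (0:ℝ), HasDerivWithinAt X' (X'' t) (Ici 0) t) ∧
        (∀ t : ℝ, 0 ≤ t → X'' t - 7 * X' t - 18 * X t = -A t) ∧
        (-9 * X 0 + X' 0 = G₀) ∧
        (∀ t : ℝ, 0 ≤ t → (T + t) ^ q * |X t| ≤ C * (M + T ^ q * |G₀|)) ∧
        (∃ α : ℝ, ∀ t : ℝ, 0 ≤ t →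
          X t = α * Real.exp (-2 * t) + Real.exp (-2 * t) *
            ∫ s in (0:ℝ)..t, Real.exp (11 * s) * ∫ τ in Ioi s, Real.exp (-9 * τ) * A τ) := by
  refine ⟨q ^ q * Real.exp 1, fun T hT A hA M hM G₀ => ?_⟩
  set K := q ^ q * Real.exp 1 with hK
  have hKpos : 0 < K := by positivity
  set B : ℝ → ℝ := fun t => A (max t 0) with hB
  have hBA : ∀ t, 0 ≤ t → B t = A t := fun t ht => by simp [hB, max_eq_left ht]
  have hBc : Continuous B :=
    hA.comp_continuous (continuous_id.max continuous_const) fun t => le_max_right t 0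
  have hM0 : 0 ≤ M :=
    (mul_nonneg (Real.rpow_nonneg (by linarith) _) (abs_nonneg _)).trans (hM 0 le_rfl)
  have hBbd : ∀ t, |B t| ≤ M := fun t =>
    (le_mul_of_one_le_left (abs_nonneg _)
      (Real.one_le_rpow (by linarith [le_max_right t 0]) hq.le)).trans (hM _ (le_max_right t 0))
  set Φ : ℝ → ℝ := fun s => ∫ τ in Ioi s, Real.exp (-9 * τ) * B τ with hΦ
  have hΦd : ∀ s, HasDerivAt Φ (-(Real.exp (-9 * s) * B s)) s :=
    hasDerivAt_integral_Ioi (by fun_prop)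
      (integrableOn_exp_mul_of_bounded hBc (by norm_num) hBbd)
  have hΦc : Continuous Φ := continuous_iff_continuousAt.2 fun s => (hΦd s).continuousAt
  set g : ℝ → ℝ := fun s => Real.exp (9 * s) * Φ s with hg
  have hgc : Continuous g := by fun_prop
  have hexp : ∀ c t : ℝ, HasDerivAt (fun t => Real.exp (c * t)) (c * Real.exp (c * t)) t :=
    fun c t => by simpa [mul_comm] using ((hasDerivAt_id t).const_mul c).exp
  have hgd : ∀ s, HasDerivAt g (9 * g s - B s) s := fun s => by
    refine ((hexp 9 s).mul (hΦd s)).congr_deriv ?_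
    have : Real.exp (9 * s) * Real.exp (-9 * s) = 1 := by
      rw [← Real.exp_add, Real.exp_eq_one_iff]; ring
    simp only [hg]
    linear_combination (-B s) * this
  have hgbd : ∀ s, 0 ≤ s → (T + s) ^ q * |g s| ≤ M / 9 := fun s hs => by
    have hw : 0 < (T + s) ^ q := Real.rpow_pos_of_pos (by linarith) _
    have h := abs_integral_Ioi_exp_mul_le (f := B) (c := -9) (s := s) (D := M / (T + s) ^ q)
      (by norm_num) fun t hst => by
        rw [le_div_iff₀ hw, hBA t (hs.trans hst.le), mul_comm]
        refine le_trans ?_ (hM t (hs.trans hst.le))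
        have : 0 ≤ T + s := by linarith
        gcongr
    have he : Real.exp (9 * s) * Real.exp (-9 * s) = 1 := by
      rw [← Real.exp_add, Real.exp_eq_one_iff]; ring
    rw [hg, abs_mul, Real.abs_exp]
    calc (T + s) ^ q * (Real.exp (9 * s) * |Φ s|)
        ≤ (T + s) ^ q * (Real.exp (9 * s) * (M / (T + s) ^ q * (Real.exp (-9 * s) / - -9))) := by
          gcongr
      _ = (T + s) ^ q / (T + s) ^ q * (Real.exp (9 * s) * Real.exp (-9 * s)) * (M / 9) := by ring
      _ = M / 9 := by rw [he, div_self hw.ne']; ring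
  set α : ℝ := (g 0 - G₀) / 11 with hα
  set J : ℝ → ℝ := fun t => ∫ s in (0 : ℝ)..t, Real.exp (2 * s) * g s with hJ
  set X : ℝ → ℝ := fun t => α * Real.exp (-2 * t) + Real.exp (-2 * t) * J t with hX
  have hXd : ∀ t, HasDerivAt X (-2 * X t + g t) t := fun t => by
    have hJd : HasDerivAt J (Real.exp (2 * t) * g t) t :=
      (Continuous.integral_hasStrictDerivAt (by fun_prop) 0 t).hasDerivAt
    refine (((hexp (-2) t).const_mul α).add ((hexp (-2) t).mul hJd)).congr_deriv ?_
    have : Real.exp (-2 * t) * Real.exp (2 * t) = 1 := by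
      rw [← Real.exp_add, Real.exp_eq_one_iff]; ring
    simp only [hX]
    linear_combination g t * this
  have hXc : Continuous X := continuous_iff_continuousAt.2 fun s => (hXd s).continuousAt
  have hX0 : X 0 = α := by simp [hX, hJ]
  refine ⟨X, fun t => -2 * X t + g t, fun t => -2 * (-2 * X t + g t) + (9 * g t - B t),
    Continuous.continuousOn (by fun_prop), fun t _ => (hXd t).hasDerivWithinAt,
    fun t _ => (((hXd t).const_mul (-2)).add (hgd t)).hasDerivWithinAt,
    fun t ht => by rw [← hBA t ht]; ring, ?_, fun t ht => ?_, α, fun t ht => ?_⟩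
  · simp only [hX0, hα]; ring
  · have hTq : 0 < T ^ q := Real.rpow_pos_of_pos (by linarith) _
    have hw : 0 < (T + t) ^ q := Real.rpow_pos_of_pos (by linarith) _
    have hJbd := rpow_mul_abs_exp_mul_integral_le hq hT (by positivity) hgbd ht
    have hαbd : T ^ q * |α| ≤ (M / 9 + T ^ q * |G₀|) / 11 := by
      have h0 := hgbd 0 le_rfl
      rw [add_zero] at h0
      rw [hα, abs_div, abs_of_pos (by norm_num : (0 : ℝ) < 11)]
      nlinarith [mul_le_mul_of_nonneg_left (abs_sub (g 0) G₀) hTq.le]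
    have hhom : (T + t) ^ q * |α * Real.exp (-2 * t)| ≤ K * (T ^ q * |α|) := by
      have h := rpow_add_le_exp_sub_mul_rpow hq hT le_rfl ht
      rw [add_zero, sub_zero] at h
      have he : Real.exp t * Real.exp (-2 * t) ≤ 1 := by
        rw [← Real.exp_add, Real.exp_le_one_iff]; linarith
      rw [abs_mul, Real.abs_exp]
      calc (T + t) ^ q * (|α| * Real.exp (-2 * t))
          ≤ K * Real.exp t * T ^ q * (|α| * Real.exp (-2 * t)) := by gcongr
        _ = K * (T ^ q * |α|) * (Real.exp t * Real.exp (-2 * t)) := by ring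
        _ ≤ K * (T ^ q * |α|) := mul_le_of_le_one_right (by positivity) he
    have hG : 0 ≤ T ^ q * |G₀| := by positivity
    calc (T + t) ^ q * |X t|
        ≤ (T + t) ^ q * (|α * Real.exp (-2 * t)| + |Real.exp (-2 * t) * J t|) := by
          gcongr
          exact abs_add_le _ _
      _ ≤ K * (T ^ q * |α|) + K * (M / 9) := by
          rw [mul_add]
          exact add_le_add hhom hJbd
      _ = K * (T ^ q * |α| + M / 9) := by ring
      _ ≤ K * (M + T ^ q * |G₀|) :=
          mul_le_mul_of_nonneg_left (by linarith) hKpos.le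
  · simp only [hX, hJ]
    congr 2
    refine intervalIntegral.integral_congr fun s hs => ?_
    rw [uIcc_of_le ht] at hs
    have hΦA : Φ s = ∫ τ in Ioi s, Real.exp (-9 * τ) * A τ :=
      setIntegral_congr_fun measurableSet_Ioi fun τ hτ => by
        simp only [hBA τ (hs.1.trans (le_of_lt hτ))]
    simp only [hg, ← hΦA]
    rw [← mul_assoc, ← Real.exp_add]
    ring_nf
end
end

section
/- Fix q > 0 and γ ∈ (−7, 0). There exists a constant C = C(q,γ), independent of T, such that for every T ≥ 1 and every continuous f : [0,∞) → ℝ with ‖f‖_{q,T} < ∞, the function w(t) := e^{−γt} ∫_t^∞ e^{(2γ+7)s} (∫_s^∞ e^{−(γ+7)τ} f(τ) dτ) ds is well defined and twice continuously differentiable on [0,∞), satisfies w''(t) − 7w'(t) − γ(γ+7)·w(t) = f(t) for all t ≥ 0, and obeys the estimate ‖w‖_{q,T} ≤ C‖f‖_{q,T}. (This is the explicit solution formula with polynomially weighted estimate used in Steps 4 and 5 of the proof of Lemma 3.1 when the indicial root γ is negative.) -/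
open Set MeasureTheory

noncomputable section

/-- A continuous function on `[0, ∞)` dominated by an antitone factor times `exp (-a t)` has
integrable tails; these are dominated in the same way, and differentiate to the negative of the
function. -/
theorem exp_decay_tail {a : ℝ} (ha : 0 < a) {h D : ℝ → ℝ} (hh : ContinuousOn h (Ici 0))
    (hD : AntitoneOn D (Ici 0)) (hb : ∀ t, 0 ≤ t → |h t| ≤ D t * Real.exp (-a * t)) :
    (∀ s, 0 ≤ s → IntegrableOn h (Ioi s)) ∧
    (∀ s, 0 ≤ s → |∫ τ in Ioi s, h τ| ≤ D s / a * Real.exp (-a * s)) ∧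
    (∀ t ∈ Ici (0 : ℝ), HasDerivWithinAt (fun s => ∫ τ in Ioi s, h τ) (-h t) (Ici 0) t) := by
  have hbs : ∀ s, 0 ≤ s → ∀ τ ∈ Ioi s, ‖h τ‖ ≤ D s * Real.exp (-a * τ) := fun s hs τ hτ =>
    (hb τ (hs.trans (mem_Ioi.1 hτ).le)).trans (mul_le_mul_of_nonneg_right
      (hD hs (hs.trans (mem_Ioi.1 hτ).le) (mem_Ioi.1 hτ).le) (Real.exp_pos _).le)
  have hexp : ∀ s, IntegrableOn (fun τ => D s * Real.exp (-a * τ)) (Ioi s) := fun s =>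
    (integrableOn_exp_mul_Ioi (neg_lt_zero.2 ha) s).const_mul _
  have hint : ∀ s, 0 ≤ s → IntegrableOn h (Ioi s) := fun s hs =>
    (hexp s).mono' ((hh.mono fun x hx => hs.trans (mem_Ioi.1 hx).le).aestronglyMeasurable
      measurableSet_Ioi) (ae_restrict_of_forall_mem measurableSet_Ioi (hbs s hs))
  refine ⟨hint, fun s hs => ?_, fun t ht => ?_⟩
  · refine (norm_integral_le_of_norm_le (hexp s)
      (ae_restrict_of_forall_mem measurableSet_Ioi (hbs s hs))).trans_eq ?_
    rw [integral_const_mul, integral_exp_mul_Ioi (neg_lt_zero.2 ha), neg_div_neg_eq]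
    ring
  · have hc : Continuous fun x => h (max x 0) :=
      hh.comp_continuous (by fun_prop) fun x => le_max_right x 0
    have hd : HasDerivAt (fun s => ∫ τ in (0 : ℝ)..s, h (max τ 0)) (h (max t 0)) t :=
      intervalIntegral.integral_hasDerivAt_right (hc.intervalIntegrable 0 t)
        (hc.stronglyMeasurableAtFilter _ _) hc.continuousAt
    rw [max_eq_left (mem_Ici.1 ht)] at hd
    have heq : ∀ s ∈ Ici (0 : ℝ), ∫ τ in Ioi s, h τ =
        (∫ τ in Ioi 0, h τ) - ∫ τ in (0 : ℝ)..s, h (max τ 0) := fun s hs => by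
      rw [← intervalIntegral.integral_interval_add_Ioi (hint 0 le_rfl) (hint s hs),
        intervalIntegral.integral_congr (f := fun τ => h (max τ 0)) (g := h) fun x hx => ?_,
        add_sub_cancel_left]
      rw [uIcc_of_le (mem_Ici.1 hs)] at hx
      simp only [max_eq_left hx.1]
    exact (hd.const_sub _).hasDerivWithinAt.congr heq (heq t ht)

/-- Fix q > 0 and γ ∈ (−7,0). There is C = C(q,γ), independent of T,
such that for every T ≥ 1 and continuous f on [0,∞) with ‖f‖_{q,T} ≤ M, the function
w(t) = e^{−γt}∫ₜ^∞ e^{(2γ+7)s}(∫ₛ^∞ e^{−(γ+7)τ}f(τ)dτ)ds is well defined, twice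
continuously differentiable on [0,∞), solves w'' − 7w' − γ(γ+7)w = f, and satisfies
‖w‖_{q,T} ≤ C‖f‖_{q,T}. -/
theorem negative_indicial_root_ode (q γ : ℝ) (hq : 0 < q) (hγ₁ : -7 < γ) (hγ₂ : γ < 0) :
    ∃ C : ℝ, ∀ T : ℝ, 1 ≤ T → ∀ f : ℝ → ℝ, ContinuousOn f (Ici 0) →
      ∀ M : ℝ, (∀ t : ℝ, 0 ≤ t → (T + t) ^ q * |f t| ≤ M) →
      let w : ℝ → ℝ := fun t => Real.exp (-γ * t) *
        ∫ s in Ioi t, Real.exp ((2 * γ + 7) * s) *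
          ∫ τ in Ioi s, Real.exp (-(γ + 7) * τ) * f τ
      (∀ s : ℝ, 0 ≤ s →
        IntegrableOn (fun τ => Real.exp (-(γ + 7) * τ) * f τ) (Ioi s)) ∧
      (∀ t : ℝ, 0 ≤ t →
        IntegrableOn (fun s => Real.exp ((2 * γ + 7) * s) *
          ∫ τ in Ioi s, Real.exp (-(γ + 7) * τ) * f τ) (Ioi t)) ∧
      ∃ w' w'' : ℝ → ℝ,
        ContinuousOn w'' (Ici 0) ∧
        (∀ t ∈ Ici (0:ℝ), HasDerivWithinAt w (w' t) (Ici 0) t) ∧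
        (∀ t ∈ Ici (0:ℝ), HasDerivWithinAt w' (w'' t) (Ici 0) t) ∧
        (∀ t : ℝ, 0 ≤ t → w'' t - 7 * w' t - γ * (γ + 7) * w t = f t) ∧
        (∀ t : ℝ, 0 ≤ t → (T + t) ^ q * |w t| ≤ C * M) := by
  refine ⟨1 / ((γ + 7) * -γ), fun T hT f hf M hM => ?_⟩
  have hpos : ∀ t : ℝ, 0 ≤ t → 0 < T + t := fun t ht => by linarith
  have hM0 : 0 ≤ M := le_trans (mul_nonneg (Real.rpow_nonneg (hpos 0 le_rfl).le q) (abs_nonneg _))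
    (hM 0 le_rfl)
  have hγ7 : 0 < γ + 7 := by linarith
  set D : ℝ → ℝ := fun t => M / (T + t) ^ q with hDdef
  have hD : AntitoneOn D (Ici 0) := fun x hx y hy hxy =>
    div_le_div_of_nonneg_left hM0 (Real.rpow_pos_of_pos (hpos x hx) q)
      (Real.rpow_le_rpow (hpos x hx).le (by linarith) hq.le)
  have hfD : ∀ t, 0 ≤ t → |f t| ≤ D t := fun t ht => by
    rw [hDdef, le_div_iff₀ (Real.rpow_pos_of_pos (hpos t ht) q), mul_comm]
    exact hM t ht
  obtain ⟨hgi, hgb, hgd⟩ := exp_decay_tail hγ7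
    (h := fun τ => Real.exp (-(γ + 7) * τ) * f τ) (ContinuousOn.mul (by fun_prop) hf) hD
    fun t ht => by
      rw [abs_mul, Real.abs_exp, mul_comm]
      exact mul_le_mul_of_nonneg_right (hfD t ht) (Real.exp_pos _).le
  set g : ℝ → ℝ := fun s => ∫ τ in Ioi s, Real.exp (-(γ + 7) * τ) * f τ
  have hgc : ContinuousOn g (Ici 0) := fun t ht => (hgd t ht).continuousWithinAt
  obtain ⟨hJi, hJb, hJd⟩ := exp_decay_tail (neg_pos.2 hγ₂)
    (h := fun s => Real.exp ((2 * γ + 7) * s) * g s) (D := fun t => D t / (γ + 7))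
    (ContinuousOn.mul (by fun_prop) hgc)
    (fun x hx y hy hxy => div_le_div_of_nonneg_right (hD hx hy hxy) hγ7.le)
    fun t ht => by
      rw [abs_mul, Real.abs_exp]
      refine (mul_le_mul_of_nonneg_left (hgb t ht) (Real.exp_pos _).le).trans_eq ?_
      rw [mul_left_comm, ← Real.exp_add]
      ring_nf
  set J : ℝ → ℝ := fun t => ∫ s in Ioi t, Real.exp ((2 * γ + 7) * s) * g s
  intro w
  have hexp : ∀ c t : ℝ, HasDerivAt (fun t => Real.exp (c * t)) (c * Real.exp (c * t)) t :=
    fun c t => by simpa [mul_comm] using ((hasDerivAt_id t).const_mul c).exp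
  set v : ℝ → ℝ := fun t => Real.exp ((γ + 7) * t) * g t
  have hw : ∀ t ∈ Ici (0 : ℝ), HasDerivWithinAt w (-γ * w t - v t) (Ici 0) t := fun t ht => by
    refine ((hexp (-γ) t).hasDerivWithinAt.mul (hJd t ht)).congr_deriv ?_
    have : Real.exp ((γ + 7) * t) = Real.exp (-γ * t) * Real.exp ((2 * γ + 7) * t) := by
      rw [← Real.exp_add]
      ring_nf
    simp only [w, v, this]
    ring
  have hvd : ∀ t ∈ Ici (0 : ℝ), HasDerivWithinAt v ((γ + 7) * v t - f t) (Ici 0) t :=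
    fun t ht => by
      refine ((hexp (γ + 7) t).hasDerivWithinAt.mul (hgd t ht)).congr_deriv ?_
      have : Real.exp ((γ + 7) * t) * Real.exp (-(γ + 7) * t) = 1 := by
        rw [← Real.exp_add, neg_mul, add_neg_cancel, Real.exp_zero]
      simp only [v]
      linear_combination (-f t) * this
  have hwc : ContinuousOn w (Ici 0) := fun t ht => (hw t ht).continuousWithinAt
  have hvc : ContinuousOn v (Ici 0) := fun t ht => (hvd t ht).continuousWithinAt
  refine ⟨hgi, hJi, fun t => -γ * w t - v t,
    fun t => -γ * (-γ * w t - v t) - ((γ + 7) * v t - f t), by fun_prop, hw,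
    fun t ht => ((hw t ht).const_mul (-γ)).sub (hvd t ht), fun t _ => by ring, fun t ht => ?_⟩
  have hT : 0 < (T + t) ^ q := Real.rpow_pos_of_pos (hpos t ht) q
  have hwb : |w t| ≤ D t / (γ + 7) / -γ := by
    change |Real.exp (-γ * t) * J t| ≤ _
    rw [abs_mul, Real.abs_exp]
    refine (mul_le_mul_of_nonneg_left (hJb t ht) (Real.exp_pos _).le).trans_eq ?_
    rw [mul_left_comm, ← Real.exp_add]
    simp
  refine (mul_le_mul_of_nonneg_left hwb hT.le).trans_eq ?_
  simp only [hDdef]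
  field_simp
end
end

section
/- Fix q > 0 and λ ≥ 5 with λ ≠ 18. There exists a constant C = C(q,λ), independent of T, such that for every T ≥ 1, every continuous f : [0,∞) → ℝ with ‖f‖_{q,T} < ∞ and every b ∈ ℝ, there exists a four times continuously differentiable w : [0,∞) → ℝ satisfying w''''(t) − 14w'''(t) + (67−2λ)w''(t) + 14(λ−9)w'(t) + (λ−18)(λ−4)w(t) = 4f(t) for all t ≥ 0, the boundary condition (λ−18)w(0) + 9w'(0) − w''(0) = b, and the estimate ‖w‖_{q,T} ≤ C(‖f‖_{q,T} + T^q|b|). (The fourth-order operator is ¼(L−λ+9+√(4λ+9))(L−λ+9−√(4λ+9)) with L = d²/dt² − 7 d/dt, i.e. the factorization of ¼(λ−L−12)(λ−L−6) − λ; this is Step 4 in the proof of Lemma 3.1, whose solvability uses λ ≥ 5 and λ ≠ 18.) -/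
open Set

noncomputable section

open Real MeasureTheory intervalIntegral

lemma exists_one_add_rpow_le_mul_exp {q a : ℝ} (hq : 0 < q) (ha : 0 < a) :
    ∃ K : ℝ, 0 ≤ K ∧ ∀ u : ℝ, 0 ≤ u → (1 + u) ^ q ≤ K * exp (a * u) := by
  refine ⟨exp (a - q - q * log (a / q)), (exp_pos _).le, fun u hu => ?_⟩
  have h1 : 0 < 1 + u := by linarith
  have h2 : 0 < a / q := div_pos ha hq
  have h3 := log_le_sub_one_of_pos (mul_pos h2 h1)
  rw [log_mul h2.ne' h1.ne'] at h3
  rw [rpow_def_of_pos h1, ← exp_add, exp_le_exp]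
  have h4 := mul_le_mul_of_nonneg_left h3 hq.le
  have h5 : q * (a / q * (1 + u) - 1) = a * (1 + u) - q := by field_simp
  linarith

/-- The weight `(T + t) ^ q` grows at most exponentially, uniformly in `T ≥ 1`. -/
lemma exists_weight_le_mul_exp {q a : ℝ} (hq : 0 < q) (ha : 0 < a) :
    ∃ K : ℝ, 0 ≤ K ∧ ∀ T : ℝ, 1 ≤ T → ∀ s t : ℝ, 0 ≤ s → s ≤ t →
      (T + t) ^ q ≤ K * exp (a * (t - s)) * (T + s) ^ q := by
  obtain ⟨K, hK, h⟩ := exists_one_add_rpow_le_mul_exp hq ha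
  refine ⟨K, hK, fun T hT s t hs hst => ?_⟩
  have h0 : 0 ≤ t - s := by linarith
  calc (T + t) ^ q ≤ ((1 + (t - s)) * (T + s)) ^ q := by
        apply rpow_le_rpow (by linarith) _ hq.le
        nlinarith
    _ = (1 + (t - s)) ^ q * (T + s) ^ q := mul_rpow (by linarith) (by linarith)
    _ ≤ _ := mul_le_mul_of_nonneg_right (h _ h0) (rpow_nonneg (by linarith) _)

/-- Variation of constants for `y' = r y + g`. -/
lemma hasDerivAt_exp_mul_add_integral {g : ℝ → ℝ} (hg : Continuous g) (r c t : ℝ) :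
    HasDerivAt (fun t => exp (r * t) * (c + ∫ τ in (0 : ℝ)..t, exp (-r * τ) * g τ))
      (r * (exp (r * t) * (c + ∫ τ in (0 : ℝ)..t, exp (-r * τ) * g τ)) + g t) t := by
  have hc : Continuous fun τ => exp (-r * τ) * g τ := by fun_prop
  have h1 := (hc.integral_hasStrictDerivAt 0 t).hasDerivAt.const_add c
  have h2 : HasDerivAt (fun t => exp (r * t)) (exp (r * t) * (r * 1)) t :=
    ((hasDerivAt_id t).const_mul r).exp
  refine (h2.mul h1).congr_deriv ?_
  have h3 : exp (r * t) * exp (-r * t) = 1 := by rw [← exp_add]; simp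
  linear_combination g t * h3

lemma weight_bound_nonneg {q T M : ℝ} {g : ℝ → ℝ} (hT : 1 ≤ T)
    (hM : ∀ t : ℝ, 0 ≤ t → (T + t) ^ q * |g t| ≤ M) : 0 ≤ M :=
  le_trans (mul_nonneg (rpow_nonneg (by linarith) _) (abs_nonneg _)) (hM 0 le_rfl)

lemma exists_firstOrder_solution_of_neg {q r : ℝ} (hq : 0 < q) (hr : r < 0) :
    ∃ C : ℝ, 0 ≤ C ∧ ∀ T : ℝ, 1 ≤ T → ∀ g : ℝ → ℝ, Continuous g →
      ∀ M : ℝ, (∀ t : ℝ, 0 ≤ t → (T + t) ^ q * |g t| ≤ M) →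
      ∀ y₀ : ℝ, ∃ y : ℝ → ℝ, y 0 = y₀ ∧ (∀ t, HasDerivAt y (r * y t + g t) t) ∧
        ∀ t : ℝ, 0 ≤ t → (T + t) ^ q * |y t| ≤ C * (M + T ^ q * |y₀|) := by
  obtain ⟨K, hK, hw⟩ := exists_weight_le_mul_exp hq (a := -r / 2) (by linarith)
  have hr2 : 0 < -2 / r := div_pos_of_neg_of_neg (by norm_num) hr
  refine ⟨K * (1 + -2 / r), by positivity, fun T hT g hg M hM y₀ =>
    ⟨_, ?_, hasDerivAt_exp_mul_add_integral hg r y₀, fun t ht => ?_⟩⟩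
  · simp
  have hM0 := weight_bound_nonneg hT hM
  have hW : 0 < (T + t) ^ q := rpow_pos_of_pos (by linarith) _
  have hTq : 0 < T ^ q := rpow_pos_of_pos (by linarith) _
  have hint : (T + t) ^ q * (exp (r * t) * |∫ τ in (0 : ℝ)..t, exp (-r * τ) * g τ|)
      ≤ K * M * (-2 / r) := by
    have hprim : ∀ τ : ℝ, HasDerivAt (fun τ => (-2 / r) * exp (r / 2 * (t - τ)))
        (exp (r / 2 * (t - τ))) τ := by
      intro τ
      have := ((((hasDerivAt_id τ).const_sub t).const_mul (r / 2)).exp).const_mul (-2 / r)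
      refine this.congr_deriv ?_
      have := hr.ne
      simp only [id]
      field_simp
    have hI : ∫ τ in (0 : ℝ)..t, exp (r / 2 * (t - τ)) ≤ -2 / r := by
      rw [integral_eq_sub_of_hasDerivAt (fun τ _ => hprim τ)
        (Continuous.intervalIntegrable (by fun_prop) _ _)]
      simp only [sub_self, mul_zero, exp_zero, mul_one]
      have : 0 ≤ -2 / r * exp (r / 2 * (t - 0)) := by positivity
      linarith
    have hle : ‖∫ τ in (0 : ℝ)..t, (T + t) ^ q * exp (r * t) * (exp (-r * τ) * g τ)‖
        ≤ ∫ τ in (0 : ℝ)..t, K * M * exp (r / 2 * (t - τ)) := by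
      refine norm_integral_le_of_norm_le ht (ae_of_all _ fun τ hτ => ?_)
        (Continuous.intervalIntegrable (by fun_prop) _ _)
      rw [norm_eq_abs, abs_mul, abs_mul, abs_mul, abs_of_pos hW, abs_exp, abs_exp]
      calc (T + t) ^ q * exp (r * t) * (exp (-r * τ) * |g τ|)
          ≤ (K * exp (-r / 2 * (t - τ)) * (T + τ) ^ q) * exp (r * t) *
              (exp (-r * τ) * |g τ|) := by
            gcongr
            exact hw T hT τ t hτ.1.le hτ.2
        _ = K * (exp (-r / 2 * (t - τ)) * exp (r * t) * exp (-r * τ)) *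
              ((T + τ) ^ q * |g τ|) := by ring
        _ = K * exp (r / 2 * (t - τ)) * ((T + τ) ^ q * |g τ|) := by
            rw [← exp_add, ← exp_add]; ring_nf
        _ ≤ K * exp (r / 2 * (t - τ)) * M := by
            gcongr
            exact hM τ hτ.1.le
        _ = _ := by ring
    rw [intervalIntegral.integral_const_mul, intervalIntegral.integral_const_mul, norm_eq_abs,
      abs_mul, abs_mul, abs_of_pos hW, abs_exp] at hle
    rw [← mul_assoc]
    exact hle.trans (by gcongr)
  have hhom : (T + t) ^ q * (exp (r * t) * |y₀|) ≤ K * (T ^ q * |y₀|) := by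
    have h1 := hw T hT 0 t le_rfl ht
    have h2 : exp (-r / 2 * (t - 0)) * exp (r * t) ≤ 1 := by
      rw [← exp_add, exp_le_one_iff]
      nlinarith
    rw [add_zero] at h1
    calc (T + t) ^ q * (exp (r * t) * |y₀|)
        ≤ (K * exp (-r / 2 * (t - 0)) * T ^ q) * (exp (r * t) * |y₀|) := by gcongr
      _ = K * (T ^ q * |y₀|) * (exp (-r / 2 * (t - 0)) * exp (r * t)) := by ring
      _ ≤ K * (T ^ q * |y₀|) * 1 := by gcongr
      _ = _ := mul_one _
  calc (T + t) ^ q * |exp (r * t) * (y₀ + ∫ τ in (0 : ℝ)..t, exp (-r * τ) * g τ)|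
      ≤ (T + t) ^ q * (exp (r * t) * (|y₀| + |∫ τ in (0 : ℝ)..t, exp (-r * τ) * g τ|)) := by
        rw [abs_mul, abs_exp]
        gcongr
        exact abs_add_le _ _
    _ ≤ K * (T ^ q * |y₀|) + K * M * (-2 / r) := by
        rw [mul_add, mul_add]
        exact add_le_add hhom hint
    _ ≤ K * (1 + -2 / r) * (M + T ^ q * |y₀|) := by
        have h1 : 0 ≤ K * M := by positivity
        have h2 : 0 ≤ K * (-2 / r) * (T ^ q * |y₀|) := by positivity
        linarith

lemma exists_firstOrder_solution_of_pos {q r : ℝ} (hq : 0 < q) (hr : 0 < r) {T : ℝ} (hT : 1 ≤ T)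
    {g : ℝ → ℝ} (hg : Continuous g) {M : ℝ} (hM : ∀ t : ℝ, 0 ≤ t → (T + t) ^ q * |g t| ≤ M) :
    ∃ y : ℝ → ℝ, (∀ t, HasDerivAt y (r * y t + g t) t) ∧
      ∀ t : ℝ, 0 ≤ t → (T + t) ^ q * |y t| ≤ r⁻¹ * M := by
  have hM0 := weight_bound_nonneg hT hM
  have hbound : ∀ t τ : ℝ, 0 ≤ t → t < τ →
      ‖exp (-r * τ) * g τ‖ ≤ ((T + t) ^ q)⁻¹ * M * exp (-r * τ) := by
    intro t τ ht hτ
    have hW : 0 < (T + t) ^ q := rpow_pos_of_pos (by linarith) _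
    have h : (T + t) ^ q * |g τ| ≤ M := by
      refine le_trans ?_ (hM τ (by linarith))
      gcongr
    have h' : |g τ| ≤ ((T + t) ^ q)⁻¹ * M := by
      rw [inv_mul_eq_div, le_div_iff₀ hW]; linarith
    rw [norm_eq_abs, abs_mul, abs_exp, mul_comm]
    gcongr
  have hexp : ∀ t c : ℝ, IntegrableOn (fun τ => c * exp (-r * τ)) (Ioi t) := fun t c =>
    (exp_neg_integrableOn_Ioi t hr).const_mul c
  have hint : ∀ t : ℝ, 0 ≤ t → IntegrableOn (fun τ => exp (-r * τ) * g τ) (Ioi t) := fun t ht =>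
    (hexp t _).mono' (Continuous.aestronglyMeasurable (by fun_prop))
      ((ae_restrict_mem measurableSet_Ioi).mono fun τ hτ => hbound t τ ht hτ)
  refine ⟨_, hasDerivAt_exp_mul_add_integral hg r (-∫ τ in Ioi 0, exp (-r * τ) * g τ),
    fun t ht => ?_⟩
  have hW : 0 < (T + t) ^ q := rpow_pos_of_pos (by linarith) _
  have hsplit := integral_interval_add_Ioi (hint 0 le_rfl) (hint t ht)
  have heq : (-∫ τ in Ioi 0, exp (-r * τ) * g τ) + ∫ τ in (0 : ℝ)..t, exp (-r * τ) * g τ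
      = -∫ τ in Ioi t, exp (-r * τ) * g τ := by linarith
  have hle : ‖∫ τ in Ioi t, exp (-r * τ) * g τ‖
      ≤ ∫ τ in Ioi t, ((T + t) ^ q)⁻¹ * M * exp (-r * τ) :=
    norm_integral_le_of_norm_le (hexp t _)
      ((ae_restrict_mem measurableSet_Ioi).mono fun τ hτ => hbound t τ ht hτ)
  rw [MeasureTheory.integral_const_mul, integral_exp_mul_Ioi (by linarith), norm_eq_abs] at hle
  rw [heq, abs_mul, abs_neg, abs_exp]
  calc _ ≤ (T + t) ^ q * (exp (r * t) * (((T + t) ^ q)⁻¹ * M * (-exp (-r * t) / -r))) := by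
        gcongr
    _ = ((T + t) ^ q * ((T + t) ^ q)⁻¹) * (exp (r * t) * exp (-r * t)) * (r⁻¹ * M) := by
        field_simp
    _ = _ := by rw [← exp_add, mul_inv_cancel₀ hW.ne']; simp

lemma exists_firstOrder_solution {q r : ℝ} (hq : 0 < q) (hr : r ≠ 0) :
    ∃ C : ℝ, 0 ≤ C ∧ ∀ T : ℝ, 1 ≤ T → ∀ g : ℝ → ℝ, Continuous g →
      ∀ M : ℝ, (∀ t : ℝ, 0 ≤ t → (T + t) ^ q * |g t| ≤ M) →
      ∃ y : ℝ → ℝ, (∀ t, HasDerivAt y (r * y t + g t) t) ∧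
        ∀ t : ℝ, 0 ≤ t → (T + t) ^ q * |y t| ≤ C * M := by
  rcases hr.lt_or_gt with hr | hr
  · obtain ⟨C, hC, h⟩ := exists_firstOrder_solution_of_neg hq hr
    refine ⟨C, hC, fun T hT g hg M hM => ?_⟩
    obtain ⟨y, -, hy, hb⟩ := h T hT g hg M hM 0
    exact ⟨y, hy, by simpa using hb⟩
  · exact ⟨r⁻¹, by positivity, fun T hT g hg M hM =>
      exists_firstOrder_solution_of_pos hq hr hT hg hM⟩

/-- Fix q > 0 and λ ≥ 5 with λ ≠ 18. There is C = C(q,λ), independent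
of T, such that for every T ≥ 1, continuous f on [0,∞) with ‖f‖_{q,T} ≤ M and every
b ∈ ℝ, there is a four times continuously differentiable w on [0,∞) with
w'''' − 14w''' + (67−2λ)w'' + 14(λ−9)w' + (λ−18)(λ−4)w = 4f on [0,∞),
(λ−18)w(0) + 9w'(0) − w''(0) = b, and (T+t)^q|w(t)| ≤ C(M + T^q|b|) for t ≥ 0. -/
theorem fourth_order_ode_solvability (q lam : ℝ) (hq : 0 < q) (hlam : 5 ≤ lam)
    (hlam' : lam ≠ 18) :
    ∃ C : ℝ, ∀ T : ℝ, 1 ≤ T → ∀ f : ℝ → ℝ, ContinuousOn f (Ici 0) →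
      ∀ M : ℝ, (∀ t : ℝ, 0 ≤ t → (T + t) ^ q * |f t| ≤ M) →
      ∀ b : ℝ, ∃ w w1 w2 w3 w4 : ℝ → ℝ,
        ContinuousOn w4 (Ici 0) ∧
        (∀ t ∈ Ici (0:ℝ), HasDerivWithinAt w (w1 t) (Ici 0) t) ∧
        (∀ t ∈ Ici (0:ℝ), HasDerivWithinAt w1 (w2 t) (Ici 0) t) ∧
        (∀ t ∈ Ici (0:ℝ), HasDerivWithinAt w2 (w3 t) (Ici 0) t) ∧
        (∀ t ∈ Ici (0:ℝ), HasDerivWithinAt w3 (w4 t) (Ici 0) t) ∧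
        (∀ t : ℝ, 0 ≤ t →
          w4 t - 14 * w3 t + (67 - 2 * lam) * w2 t + 14 * (lam - 9) * w1 t
            + (lam - 18) * (lam - 4) * w t = 4 * f t) ∧
        ((lam - 18) * w 0 + 9 * w1 0 - w2 0 = b) ∧
        (∀ t : ℝ, 0 ≤ t → (T + t) ^ q * |w t| ≤ C * (M + T ^ q * |b|)) := by
  set s : ℝ := √(4 * lam + 9) with hs_def
  have hs2 : s ^ 2 = 4 * lam + 9 := sq_sqrt (by linarith)
  have hs0 : 0 ≤ s := sqrt_nonneg _
  have hs5 : 5 < s := by nlinarith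
  have hs9 : 9 - s ≠ 0 := fun h => hlam' (by nlinarith)
  have hlam_eq : lam = (s ^ 2 - 9) / 4 := by linarith
  let r₁ : ℝ := (9 + s) / 2
  let r₂ : ℝ := (5 + s) / 2
  let r₃ : ℝ := (9 - s) / 2
  let r₄ : ℝ := (5 - s) / 2
  obtain ⟨C₁, hC₁, H₁⟩ := exists_firstOrder_solution (r := r₁) hq (by positivity)
  obtain ⟨C₂, hC₂, H₂⟩ := exists_firstOrder_solution (r := r₂) hq (by positivity)
  obtain ⟨C₃, hC₃, H₃⟩ :=
    exists_firstOrder_solution (r := r₃) hq (div_ne_zero hs9 two_ne_zero)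
  obtain ⟨C₄, hC₄, H₄⟩ :=
    exists_firstOrder_solution_of_neg (r := r₄) hq (show (5 - s) / 2 < 0 by linarith)
  have hD : 0 < 4 + 2 * s := by positivity
  let A : ℝ := C₃ * (C₂ * (C₁ * 4)) + ((2 + s) * (C₃ * (C₂ * (C₁ * 4))) + C₂ * (C₁ * 4))
  have hA : 0 ≤ A := by positivity
  refine ⟨C₄ * (1 + A), fun T hT f hf M hM b => ?_⟩
  have hM0 := weight_bound_nonneg hT hM
  have hTq : 0 < T ^ q := rpow_pos_of_pos (by linarith) _
  have hg : Continuous fun t => 4 * f (max t 0) :=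
    (hf.comp_continuous (continuous_id.max continuous_const) fun t => le_max_right t 0).const_mul 4
  obtain ⟨z, hz, hzM⟩ := H₁ T hT _ hg (4 * M) fun t ht => by
    have := hM t ht
    rw [max_eq_left ht, abs_mul, abs_of_pos (four_pos : (0 : ℝ) < 4)]
    linarith
  have hz_cont : Continuous z := continuous_iff_continuousAt.2 fun t => (hz t).continuousAt
  obtain ⟨v, hv, hvM⟩ := H₂ T hT z hz_cont _ hzM
  have hv_cont : Continuous v := continuous_iff_continuousAt.2 fun t => (hv t).continuousAt
  obtain ⟨u, hu, huM⟩ := H₃ T hT v hv_cont _ hvM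
  have hu_cont : Continuous u := continuous_iff_continuousAt.2 fun t => (hu t).continuousAt
  obtain ⟨w, hw0, hw, hwM⟩ := H₄ T hT u hu_cont _ huM
    (-(b - (2 + s) * u 0 + v 0) / (4 + 2 * s))
  have hw_cont : Continuous w := continuous_iff_continuousAt.2 fun t => (hw t).continuousAt
  have hv1 := fun t => ((hv t).const_mul r₂).add (hz t)
  have hu1 := fun t => ((hu t).const_mul r₃).add (hv t)
  have hu2 := fun t => ((hu1 t).const_mul r₃).add (hv1 t)
  have hw1 := fun t => ((hw t).const_mul r₄).add (hu t)
  have hw2 := fun t => ((hw1 t).const_mul r₄).add (hu1 t)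
  have hw3 := fun t => ((hw2 t).const_mul r₄).add (hu2 t)
  have hv0 : T ^ q * |v 0| ≤ C₂ * (C₁ * (4 * M)) := by simpa using hvM 0 le_rfl
  have hu0 : T ^ q * |u 0| ≤ C₃ * (C₂ * (C₁ * (4 * M))) := by simpa using huM 0 le_rfl
  refine ⟨w, fun t => r₄ * w t + u t, fun t => r₄ * (r₄ * w t + u t) + (r₃ * u t + v t),
    fun t => r₄ * (r₄ * (r₄ * w t + u t) + (r₃ * u t + v t)) +
      (r₃ * (r₃ * u t + v t) + (r₂ * v t + z t)),
    fun t => r₄ * (r₄ * (r₄ * (r₄ * w t + u t) + (r₃ * u t + v t)) +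
      (r₃ * (r₃ * u t + v t) + (r₂ * v t + z t))) +
      (r₃ * (r₃ * (r₃ * u t + v t) + (r₂ * v t + z t)) +
        (r₂ * (r₂ * v t + z t) + (r₁ * z t + 4 * f (max t 0)))),
    Continuous.continuousOn (by fun_prop), fun t _ => (hw t).hasDerivWithinAt,
    fun t _ => (hw1 t).hasDerivWithinAt, fun t _ => (hw2 t).hasDerivWithinAt,
    fun t _ => (hw3 t).hasDerivWithinAt, fun t ht => ?_, ?_, fun t ht => ?_⟩
  · simp only [max_eq_left ht, hlam_eq, r₁, r₂, r₃, r₄]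
    ring
  · rw [eq_div_iff hD.ne'] at hw0
    simp only [hlam_eq, r₃, r₄]
    linear_combination -hw0
  · refine (hwM t ht).trans ?_
    rw [mul_assoc]
    gcongr
    rw [abs_div, abs_neg, abs_of_pos hD]
    have h1 : |b - (2 + s) * u 0 + v 0| ≤ |b| + (2 + s) * |u 0| + |v 0| := by
      refine (abs_add_le _ _).trans (add_le_add_left ((abs_sub _ _).trans_eq ?_) _)
      rw [abs_mul, abs_of_pos (by positivity : 0 < 2 + s)]
    have h2 : T ^ q * (|b - (2 + s) * u 0 + v 0| / (4 + 2 * s)) ≤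
        T ^ q * (|b| + (2 + s) * |u 0| + |v 0|) := by
      gcongr
      exact (div_le_self (abs_nonneg _) (by linarith)).trans h1
    have h3 := mul_le_mul_of_nonneg_left hu0 (by positivity : 0 ≤ 2 + s)
    have h4 : 0 ≤ A * (T ^ q * |b|) := by positivity
    have h5 : A * M = C₃ * (C₂ * (C₁ * (4 * M))) +
        ((2 + s) * (C₃ * (C₂ * (C₁ * (4 * M)))) + C₂ * (C₁ * (4 * M))) := by
      simp only [A]
      ring
    linarith
end
end
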